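/- Let p be a prime, let q be a prime power coprime to p, and let G be a minimal irreducible ESQ-subgroup of GL_p(F_q) (i.e., G acts irreducibly on V = (F_q)^p, V is an ESQ module for G, and every proper subgroup of G acts reducibly on V). If G is not absolutely irreducible on V, then G is cyclic of prime order r, the multiplicative order of q modulo r equals p, and there exist distinct elements α, β of the subgroup ⟨q⟩ of the multiplicative group F_r^× such that α + β = 1 in F_r. -/

import Mathlib

open TensorProduct

section ExteriorSquare

variable (F : Type*) [Field F] (V : Type*) [AddCommGroup V] [Module F V]

/-- The submodule of `V ⊗ V` spanned by the squares `v ⊗ v`. -/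
def sqSub : Submodule F (V ⊗[F] V) :=
  Submodule.span F {x : V ⊗[F] V | ∃ v : V, x = v ⊗ₜ[F] v}

/-- The exterior square `Λ²V`, realised as `V ⊗ V` modulo the squares. -/
abbrev Wedge2 := (V ⊗[F] V) ⧸ sqSub F V

variable {F V}

/-- The map `Λ²g = g ∧ g` induced on the exterior square by `g : V → V`. -/
noncomputable def wedge2Map (g : V →ₗ[F] V) : Wedge2 F V →ₗ[F] Wedge2 F V :=
  Submodule.mapQ _ _ (TensorProduct.map g g) (by
    rw [← Submodule.map_le_iff_le_comap, sqSub, Submodule.map_span]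
    refine Submodule.span_le.2 ?_
    rintro _ ⟨_, ⟨v, rfl⟩, rfl⟩
    exact Submodule.subset_span ⟨g v, by simp⟩)

end ExteriorSquare

section LinearGroups

variable {n : ℕ} {F : Type*} [Field F]

/-- The natural action of `g ∈ GL_n(F)` on row vectors. -/
def natAct (g : GL (Fin n) F) : (Fin n → F) →ₗ[F] (Fin n → F) :=
  Matrix.vecMulLinear (g : Matrix (Fin n) (Fin n) F)

/-- `G ≤ GL_n(F)` acts irreducibly on the natural module `F^n`. -/
def IsIrred (G : Subgroup (GL (Fin n) F)) : Prop :=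
  ∀ S : Submodule F (Fin n → F),
    (∀ g ∈ G, Submodule.map (natAct g) S = S) → S = ⊥ ∨ S = ⊤

/-- The natural module `F^n` is an exterior self-quotient (ESQ) module for
`G ≤ GL_n(F)`: there is a `G`-invariant submodule `U ≤ Λ²(F^n)` and a
`G`-equivariant isomorphism `Λ²(F^n)/U ≃ F^n`. -/
def IsESQ (G : Subgroup (GL (Fin n) F)) : Prop :=
  ∃ (U : Submodule F (Wedge2 F (Fin n → F)))
    (e : ((Wedge2 F (Fin n → F)) ⧸ U) ≃ₗ[F] (Fin n → F)),
    (∀ g ∈ G, Submodule.map (wedge2Map (natAct g)) U ≤ U) ∧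
    ∀ g ∈ G, ∀ w : Wedge2 F (Fin n → F),
      e (Submodule.Quotient.mk (wedge2Map (natAct g) w)) =
        natAct g (e (Submodule.Quotient.mk w))

/-- `G ≤ GL_n(F)` is absolutely irreducible: it remains irreducible over the
algebraic closure of `F`. -/
def IsAbsIrred (G : Subgroup (GL (Fin n) F)) : Prop :=
  ∀ S : Submodule (AlgebraicClosure F) (Fin n → AlgebraicClosure F),
    (∀ g ∈ G, Submodule.map
        (Matrix.vecMulLinear
          ((g : Matrix (Fin n) (Fin n) F).map (algebraMap F (AlgebraicClosure F)))) S = S) →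
      S = ⊥ ∨ S = ⊤

/-- `G` is a minimal irreducible ESQ-subgroup of `GL_n(F)`: it is irreducible,
the natural module is ESQ for `G`, and every proper subgroup acts reducibly. -/
def IsMinIrredESQ (G : Subgroup (GL (Fin n) F)) : Prop :=
  IsIrred G ∧ IsESQ G ∧
    ∀ H : Subgroup (GL (Fin n) F), H < G → ¬ IsIrred H

end LinearGroups

section

open Module

/-- Burnside's theorem: an irreducible algebra whose commutant is scalar is everything. -/
theorem Subalgebra.eq_top_of_isSimpleModule {F M : Type*} [Field F] [AddCommGroup M] [Module F M]
    [FiniteDimensional F M] (A : Subalgebra F (End F M)) [IsSimpleModule A M]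
    (h : ∀ T : End F M, (∀ a ∈ A, Commute a T) → T ∈ (⊥ : Subalgebra F (End F M))) :
    A = ⊤ := by
  refine eq_top_iff.2 fun f _ => ?_
  have hcomm : ∀ (T : End A M) (m : M), f (T m) = T (f m) := by
    intro T m
    let T' : End F M := T.restrictScalars F
    have hT' : T' ∈ (⊥ : Subalgebra F (End F M)) := h T' fun a ha =>
      LinearMap.ext fun m => (T.map_smul (⟨a, ha⟩ : A) m).symm
    obtain ⟨c, hc⟩ := Algebra.mem_bot.1 hT'
    have hTc : ∀ m, T m = c • m := fun m => by
      rw [← Module.algebraMap_end_apply (S := F), hc]; rfl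
    rw [hTc, hTc, map_smul]
  let f' : End (End A M) M :=
    { toFun := f, map_add' := map_add f, map_smul' := fun T m => hcomm T m }
  let b := Module.finBasis F M
  classical
  obtain ⟨r, hr⟩ := jacobson_density f' (Finset.univ.image b)
  have : f = r := b.ext fun i => hr (b i) (by simp)
  exact this ▸ r.2

theorem Module.End.exists_field_of_commuting {F M : Type} [Field F] [AddCommGroup M] [Module F M]
    [FiniteDimensional F M] (hp : (finrank F M).Prime) (X : Set (End F M))
    (hX : ∀ S : Submodule F M, (∀ x ∈ X, S ≤ S.comap x) → S = ⊥ ∨ S = ⊤)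
    (T : End F M) (hTX : ∀ x ∈ X, Commute x T) (hT : T ∉ (⊥ : Subalgebra F (End F M))) :
    ∃ (E : Type) (_ : Field E) (_ : Algebra F E) (ρ : E →ₐ[F] End F M),
      (∀ v ≠ 0, Function.Bijective fun x => ρ x v) ∧ ∀ x ∈ X, x ∈ ρ.range := by
  have : Nontrivial M := Module.nontrivial_of_finrank_pos hp.pos
  have hint : IsIntegral F T := Algebra.IsIntegral.isIntegral T
  have key : ∀ a : Polynomial F, Polynomial.aeval T a = 0 ∨
      Function.Injective (Polynomial.aeval T a) := by
    intro a
    have hc : ∀ x ∈ X, Commute x (Polynomial.aeval T a) := fun x hx =>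
      (Algebra.commute_of_mem_adjoin_singleton_of_commute
        (Polynomial.aeval_mem_adjoin_singleton F T) (hTX x hx))
    rcases hX (LinearMap.ker (Polynomial.aeval T a)) fun x hx m hm => by
      have := LinearMap.congr_fun (hc x hx) m
      simp only [Module.End.mul_apply] at this
      simp only [Submodule.mem_comap, LinearMap.mem_ker] at hm ⊢
      rw [← this, hm, map_zero] with h | h
    · exact Or.inr (LinearMap.ker_eq_bot.1 h)
    · exact Or.inl (LinearMap.ker_eq_top.1 h)
  have hprime : Prime (minpoly F T) := by
    refine ⟨minpoly.ne_zero hint, minpoly.not_isUnit F T, fun a b hab => ?_⟩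
    have h0 : Polynomial.aeval T a * Polynomial.aeval T b = 0 := by
      rw [← map_mul]; exact (minpoly.dvd_iff).1 hab
    rcases key a with ha | ha
    · exact Or.inl (minpoly.dvd F T ha)
    rcases key b with hb | hb
    · exact Or.inr (minpoly.dvd F T hb)
    obtain ⟨m, hm⟩ := exists_ne (0 : M)
    have := LinearMap.congr_fun h0 m
    exact absurd (hb (ha (by simpa using this) : _ = (Polynomial.aeval T b) 0)) hm
  have : Fact (Irreducible (minpoly F T)) := ⟨hprime.irreducible⟩
  let ρ : AdjoinRoot (minpoly F T) →ₐ[F] End F M :=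
    Ideal.Quotient.liftₐ (Ideal.span {minpoly F T}) (Polynomial.aeval T) fun a ha =>
      minpoly.dvd_iff.1 (Ideal.mem_span_singleton.1 ha)
  have hρ : ∀ P, ρ (AdjoinRoot.mk _ P) = Polynomial.aeval T P := fun P => rfl
  have hρT : ρ (AdjoinRoot.root _) = T := (hρ _).trans (Polynomial.aeval_X T)
  have hfd : FiniteDimensional F (AdjoinRoot (minpoly F T)) :=
    (AdjoinRoot.powerBasis (minpoly.ne_zero hint)).finite
  have hinj : ∀ v ≠ 0, Function.Injective fun x => ρ x v := by
    intro v hv x y hxy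
    by_contra hne
    apply hv
    have h1 : ρ (x - y) v = 0 := by simpa [sub_eq_zero] using hxy
    have h2 : ρ ((x - y)⁻¹ * (x - y)) v = v := by
      rw [inv_mul_cancel₀ (sub_ne_zero.2 hne), map_one]; rfl
    rw [← h2, map_mul, Module.End.mul_apply, h1, map_zero]
  have hfin : finrank F (AdjoinRoot (minpoly F T)) = finrank F M := by
    let _ : Module (AdjoinRoot (minpoly F T)) M := Module.compHom M ρ.toRingHom
    have : IsScalarTower F (AdjoinRoot (minpoly F T)) M := ⟨fun c x m => by
      change ρ (c • x) m = c • ρ x m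
      simp⟩
    refine (hp.eq_one_or_self_of_dvd _ (Dvd.intro _
      (finrank_mul_finrank F (AdjoinRoot (minpoly F T)) M))).resolve_left fun h1 => hT ?_
    have := Subalgebra.bot_eq_top_of_finrank_eq_one h1
    obtain ⟨c, hc⟩ := Algebra.mem_bot.1
      (this ▸ Algebra.mem_top : AdjoinRoot.root (minpoly F T) ∈ (⊥ : Subalgebra F _))
    rw [← hρT, ← hc, AlgHom.commutes]
    exact Algebra.mem_bot.2 ⟨c, rfl⟩
  have hbij : ∀ v ≠ 0, Function.Bijective fun x => ρ x v := by
    intro v hv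
    refine ⟨hinj v hv, ?_⟩
    let L : AdjoinRoot (minpoly F T) →ₗ[F] M := (LinearMap.applyₗ v).comp ρ.toLinearMap
    exact (LinearMap.injective_iff_surjective_of_finrank_eq_finrank hfin (f := L)).1 (hinj v hv)
  refine ⟨_, inferInstance, inferInstance, ρ, hbij, fun x hx => ?_⟩
  obtain ⟨v, hv⟩ := exists_ne (0 : M)
  obtain ⟨a, ha⟩ := (hbij v hv).2 (x v)
  refine ⟨a, LinearMap.ext fun m => ?_⟩
  obtain ⟨y, rfl⟩ := (hbij v hv).2 m
  have hc : Commute x (ρ y) := by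
    obtain ⟨P, rfl⟩ := AdjoinRoot.mk_surjective y
    rw [hρ]
    exact Algebra.commute_of_mem_adjoin_singleton_of_commute
        (Polynomial.aeval_mem_adjoin_singleton F T) (hTX x hx)
  have h2 := LinearMap.congr_fun hc v
  simp only [Module.End.mul_apply] at h2 ha
  change ρ a (ρ y v) = x (ρ y v)
  rw [h2, ← ha, ← Module.End.mul_apply, ← Module.End.mul_apply, ← map_mul, ← map_mul, mul_comm]

end

section

open Module

/-- The automorphisms of a Galois extension form a basis of the space of linear endomorphisms. -/
noncomputable def galoisEndBasis (F E : Type*) [Field F] [Field E] [Algebra F E] [FiniteDimensional F E]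
    [IsGalois F E] : Basis (E ≃ₐ[F] E) E (E →ₗ[F] E) :=
  basisOfLinearIndependentOfCardEqFinrank
    ((linearIndependent_toLinearMap F E E).comp (fun σ : E ≃ₐ[F] E => (σ : E →ₐ[F] E))
      fun _ _ h => AlgEquiv.coe_toAlgHom_injective h)
    (by rw [Module.finrank_linearMap_self, ← Nat.card_eq_fintype_card,
      IsGalois.card_aut_eq_finrank])

section

variable {F E : Type*} [Field F] [Field E] [Algebra F E] [FiniteDimensional F E] [IsGalois F E]

theorem galoisEndBasis_apply (σ : E ≃ₐ[F] E) (x : E) : galoisEndBasis F E σ x = σ x := by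
  simp [galoisEndBasis]

theorem sum_galoisEndBasis_repr (T : E →ₗ[F] E) (x : E) :
    ∑ σ, (galoisEndBasis F E).repr T σ * σ x = T x := by
  conv_rhs => rw [← (galoisEndBasis F E).sum_repr T]
  simp only [LinearMap.sum_apply, LinearMap.smul_apply, galoisEndBasis_apply, smul_eq_mul]

theorem galoisEndBasis_repr_comp_mul (T : E →ₗ[F] E) (c : E) (σ : E ≃ₐ[F] E) :
    (galoisEndBasis F E).repr (T.comp (LinearMap.mulLeft F c)) σ = (galoisEndBasis F E).repr T σ * σ c := by
  have : T.comp (LinearMap.mulLeft F c) =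
      ∑ σ, ((galoisEndBasis F E).repr T σ * σ c) • galoisEndBasis F E σ := by
    ext x
    simp [LinearMap.sum_apply, galoisEndBasis_apply, ← sum_galoisEndBasis_repr T, mul_assoc]
  rw [this, Basis.repr_sum_self]

/-- A nonzero alternating form equivariant for multiplication by `c` relates conjugates of `c`. -/
theorem exists_ne_mul_eq_of_alternating [Finite E] (B : E →ₗ[F] E →ₗ[F] E) (hB : B ≠ 0)
    (halt : ∀ x, B x x = 0) (c : E) (hc : ∀ x y, B (c * x) (c * y) = c * B x y) :
    ∃ σ τ : E ≃ₐ[F] E, σ ≠ τ ∧ σ c * τ c = c := by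
  let coef (σ : E ≃ₐ[F] E) : E →ₗ[F] E :=
    (((galoisEndBasis F E).coord σ).restrictScalars F).comp B
  have hcoef : ∀ σ x, coef σ x = (galoisEndBasis F E).repr (B x) σ := fun σ x => rfl
  have hBsum : ∀ x y, B x y = ∑ σ, (∑ τ, (galoisEndBasis F E).repr (coef σ) τ * τ x) * σ y := by
    intro x y
    simp only [sum_galoisEndBasis_repr]
    simp only [hcoef, sum_galoisEndBasis_repr]
  have hequi : ∀ σ τ, (galoisEndBasis F E).repr (coef σ) τ * (σ c * τ c - c) = 0 := by
    intro σ τ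
    have h1 : ∀ x, (coef σ).comp (LinearMap.mulLeft F c) x * σ c = c * coef σ x := by
      intro x
      have : (B (c * x)).comp (LinearMap.mulLeft F c) = c • B x := by
        ext y; simp [hc]
      have h2 := galoisEndBasis_repr_comp_mul (B (c * x)) c σ
      rw [this] at h2
      simpa [hcoef] using h2.symm
    have h3 : σ c • (coef σ).comp (LinearMap.mulLeft F c) = c • coef σ := by
      ext x
      simpa [mul_comm] using h1 x
    have h4 := congrArg (fun T => (galoisEndBasis F E).repr T τ) h3
    simp only [map_smul, Finsupp.smul_apply, galoisEndBasis_repr_comp_mul, smul_eq_mul] at h4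
    linear_combination h4
  by_contra! hcon
  have hoff : ∀ σ τ, σ ≠ τ → (galoisEndBasis F E).repr (coef σ) τ = 0 := fun σ τ hne =>
    (mul_eq_zero.1 (hequi σ τ)).resolve_right (sub_ne_zero.2 (hcon σ τ hne))
  have hprod : ∀ x y, B x y = B 1 (x * y) := by
    intro x y
    rw [hBsum, hBsum]
    refine Finset.sum_congr rfl fun σ _ => ?_
    rw [Finset.sum_eq_single σ (fun τ _ h => by rw [hoff σ τ h.symm, zero_mul]) (by simp),
      Finset.sum_eq_single σ (fun τ _ h => by rw [hoff σ τ h.symm, zero_mul]) (by simp)]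
    simp [mul_assoc]
  have hsq : ∀ x, B 1 (x * x) = 0 := fun x => by rw [← hprod, halt]
  have hzero : ∀ z, B 1 z = 0 := by
    intro z
    by_cases h2 : ringChar E = 2
    · obtain ⟨x, rfl⟩ := FiniteField.isSquare_of_char_two h2 z
      exact hsq x
    · have h2' : (2 : E) ≠ 0 := Ring.two_ne_zero h2
      have h4 : z = ((z + 1) / 2) * ((z + 1) / 2) - ((z - 1) / 2) * ((z - 1) / 2) := by
        field_simp; ring
      rw [h4, map_sub, hsq, hsq, sub_zero]
  exact hB (LinearMap.ext fun x => LinearMap.ext fun y => by rw [hprod, hzero]; rfl)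

end

theorem FiniteField.exists_pow_eq_algEquiv {F E : Type*} [Field F] [Fintype F] [Field E] [Finite E]
    [Algebra F E] (σ : E ≃ₐ[F] E) :
    ∃ i < finrank F E, σ = FiniteField.frobeniusAlgEquivOfAlgebraic F E ^ i :=
  have ⟨i, hi⟩ := (FiniteField.bijective_frobeniusAlgEquivOfAlgebraic_pow F E).2 σ
  ⟨i, i.2, hi.symm⟩

theorem exists_pow_mul_pow_eq_of_alternating {F E : Type*} [Field F] [Fintype F] [Field E]
    [Finite E] [Algebra F E] (B : E →ₗ[F] E →ₗ[F] E) (hB : B ≠ 0)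
    (halt : ∀ x, B x x = 0) (c : E) (hc : ∀ x y, B (c * x) (c * y) = c * B x y) :
    ∃ i < finrank F E, ∃ j < finrank F E, i ≠ j ∧
      c ^ Fintype.card F ^ i * c ^ Fintype.card F ^ j = c := by
  obtain ⟨σ, τ, hne, h⟩ := exists_ne_mul_eq_of_alternating B hB halt c hc
  obtain ⟨i, hi, rfl⟩ := FiniteField.exists_pow_eq_algEquiv σ
  obtain ⟨j, hj, rfl⟩ := FiniteField.exists_pow_eq_algEquiv τ
  refine ⟨i, hi, j, hj, fun hij => hne (by rw [hij]), ?_⟩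
  simpa only [AlgEquiv.coe_pow, FiniteField.coe_frobeniusAlgEquivOfAlgebraic_iterate] using h

theorem FiniteField.mem_bot_of_pow_card_eq {F E : Type*} [Field F] [Fintype F] [Field E]
    [Finite E] [Algebra F E] {x : E} (hx : x ^ Fintype.card F = x) :
    x ∈ (⊥ : Subalgebra F E) := by
  refine (IsGalois.mem_bot_iff_fixed (F := F) x).2 fun σ => ?_
  obtain ⟨i, -, rfl⟩ := FiniteField.exists_pow_eq_algEquiv σ
  rw [AlgEquiv.coe_pow]
  exact Function.iterate_fixed hx i

end

section LinearGroups

open Module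

variable {n : ℕ} {F : Type*} [Field F]

theorem natAct_apply (g : GL (Fin n) F) (v : Fin n → F) :
    natAct g v = Matrix.vecMul v (g : Matrix (Fin n) (Fin n) F) := rfl

theorem natAct_one : natAct (1 : GL (Fin n) F) = 1 :=
  LinearMap.ext fun v => by simp [natAct_apply]

theorem natAct_mul (g h : GL (Fin n) F) : natAct (g * h) = natAct h * natAct g :=
  LinearMap.ext fun v => by simp [natAct_apply]

theorem natAct_injective : Function.Injective (natAct : GL (Fin n) F → _) := fun _ _ hgh =>
  Units.ext (Matrix.ext_of_single_vecMul fun _ => LinearMap.congr_fun hgh _)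

theorem IsIrred.eq_bot_or_eq_top {G : Subgroup (GL (Fin n) F)} (hG : IsIrred G)
    (S : Submodule F (Fin n → F)) (hS : ∀ g ∈ G, S ≤ S.comap (natAct g)) : S = ⊥ ∨ S = ⊤ := by
  refine hG S fun g hg => le_antisymm (Submodule.map_le_iff_le_comap.2 (hS g hg)) fun v hv => ?_
  refine ⟨natAct g⁻¹ v, hS g⁻¹ (G.inv_mem hg) hv, ?_⟩
  rw [← Module.End.mul_apply, ← natAct_mul, inv_mul_cancel, natAct_one, Module.End.one_apply]

theorem IsAbsIrred.of_adjoin_eq_top {G : Subgroup (GL (Fin n) F)}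
    (h : Algebra.adjoin F (natAct '' (G : Set (GL (Fin n) F))) = ⊤) : IsAbsIrred G := by
  intro S hS
  let K := AlgebraicClosure F
  have key : ∀ T ∈ Algebra.adjoin F (natAct '' (G : Set (GL (Fin n) F))),
      ∃ N : Matrix (Fin n) (Fin n) F, Matrix.vecMulLinear N = T ∧
        ∀ v ∈ S, Matrix.vecMul v (N.map (algebraMap F K)) ∈ S := by
    intro T hT
    induction hT using Algebra.adjoin_induction with
    | mem x hx =>
      obtain ⟨g, hg, rfl⟩ := hx
      exact ⟨g, rfl, fun v hv => (hS g hg).le (Submodule.mem_map_of_mem hv)⟩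
    | algebraMap c =>
      refine ⟨c • 1, LinearMap.ext fun v => ?_, fun v hv => ?_⟩
      · simp
      · have : (c • (1 : Matrix (Fin n) (Fin n) F)).map (algebraMap F K) =
            algebraMap F K c • 1 := by
          ext i j; by_cases h : i = j <;> simp [h]
        rw [this, Matrix.vecMul_smul, Matrix.vecMul_one]
        exact S.smul_mem _ hv
    | add x y _ _ hx hy =>
      obtain ⟨N, rfl, hN⟩ := hx
      obtain ⟨N', rfl, hN'⟩ := hy
      refine ⟨N + N', LinearMap.ext fun v => by simp, fun v hv => ?_⟩
      rw [Matrix.map_add _ (map_add _), Matrix.vecMul_add]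
      exact S.add_mem (hN v hv) (hN' v hv)
    | mul x y _ _ hx hy =>
      obtain ⟨N, rfl, hN⟩ := hx
      obtain ⟨N', rfl, hN'⟩ := hy
      refine ⟨N' * N, LinearMap.ext fun v => by simp, fun v hv => ?_⟩
      rw [Matrix.map_mul, ← Matrix.vecMul_vecMul]
      exact hN _ (hN' v hv)
  have hall : ∀ N : Matrix (Fin n) (Fin n) F, ∀ v ∈ S,
      Matrix.vecMul v (N.map (algebraMap F K)) ∈ S := by
    intro N
    obtain ⟨N', hN', h'⟩ := key (Matrix.vecMulLinear N) (h ▸ Algebra.mem_top)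
    have : N' = N := Matrix.ext_of_single_vecMul fun i => LinearMap.congr_fun hN' _
    exact this ▸ h'
  refine or_iff_not_imp_left.2 fun hne => eq_top_iff.2 fun w _ => ?_
  obtain ⟨v, hv, hv0⟩ := S.exists_mem_ne_zero_of_ne_bot hne
  obtain ⟨i, hi⟩ := Function.ne_iff.1 hv0
  rw [pi_eq_sum_univ' w]
  refine S.sum_mem fun j _ => S.smul_mem _ ?_
  have h1 := S.smul_mem (v i)⁻¹ (hall (Matrix.single i j 1) v hv)
  convert h1 using 1
  ext k
  rw [Matrix.map_single, map_one]
  rcases eq_or_ne k j with rfl | hk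
  · simp [Matrix.vecMul, dotProduct, Matrix.single_apply, inv_mul_cancel₀ hi]
  · simp [Matrix.vecMul, dotProduct, hk, hk.symm]

theorem IsIrred.exists_commute_of_not_isAbsIrred [NeZero n] {G : Subgroup (GL (Fin n) F)}
    (hG : IsIrred G) (hnabs : ¬ IsAbsIrred G) :
    ∃ T : End F (Fin n → F), (∀ g ∈ G, Commute (natAct g) T) ∧
      T ∉ (⊥ : Subalgebra F (End F (Fin n → F))) := by
  by_contra! hcon
  let A := Algebra.adjoin F (natAct '' (G : Set (GL (Fin n) F)))
  have hA : ∀ g ∈ G, natAct g ∈ A := fun g hg => Algebra.subset_adjoin ⟨g, hg, rfl⟩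
  have : IsSimpleModule A (Fin n → F) := by
    refine isSimpleModule_iff _ _ |>.2 ⟨fun S => ?_⟩
    have := hG.eq_bot_or_eq_top (S.restrictScalars F) fun g hg v hv =>
      S.smul_mem (⟨natAct g, hA g hg⟩ : A) hv
    simpa using this
  exact hnabs (.of_adjoin_eq_top (A.eq_top_of_isSimpleModule fun T hT =>
    hcon T fun g hg => hT _ (hA g hg)))

/-- The bilinear form on the natural module induced by an ESQ structure. -/
theorem IsESQ.exists_alternating [NeZero n] {G : Subgroup (GL (Fin n) F)} (hG : IsESQ G) :
    ∃ B : (Fin n → F) →ₗ[F] (Fin n → F) →ₗ[F] (Fin n → F), B ≠ 0 ∧ (∀ v, B v v = 0) ∧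
      ∀ g ∈ G, ∀ v w, B (natAct g v) (natAct g w) = natAct g (B v w) := by
  obtain ⟨U, e, -, he⟩ := hG
  let L : TensorProduct F (Fin n → F) (Fin n → F) →ₗ[F] (Fin n → F) :=
    e.toLinearMap ∘ₗ U.mkQ ∘ₗ (sqSub F (Fin n → F)).mkQ
  have hLsurj : Function.Surjective L :=
    e.surjective.comp ((Submodule.mkQ_surjective _).comp (Submodule.mkQ_surjective _))
  refine ⟨TensorProduct.curry L, fun h0 => ?_, fun v => ?_, fun g hg v w => ?_⟩
  · have hL0 : L = 0 := TensorProduct.ext' fun v w => LinearMap.congr_fun₂ h0 v w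
    obtain ⟨v, hv⟩ := exists_ne (0 : Fin n → F)
    obtain ⟨x, hx⟩ := hLsurj v
    exact hv (by rw [← hx, hL0]; rfl)
  · have : (sqSub F (Fin n → F)).mkQ (v ⊗ₜ[F] v) = 0 :=
      (Submodule.Quotient.mk_eq_zero _).2 (Submodule.subset_span ⟨v, rfl⟩)
    simp [L, this]
  · exact he g hg (Submodule.Quotient.mk (v ⊗ₜ[F] w))

end LinearGroups

theorem stmt12 (p : ℕ) (hp : p.Prime) (F : Type) [Field F] [Fintype F]
    (hcop : Nat.Coprime (Fintype.card F) p)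
    (G : Subgroup (GL (Fin p) F)) (hG : IsMinIrredESQ G)
    (hnabs : ¬ IsAbsIrred G) :
    ∃ r : ℕ, r.Prime ∧ IsCyclic G ∧ Nat.card G = r ∧
      -- the multiplicative order of `q` modulo `r` is `p`
      orderOf ((Fintype.card F : ZMod r)) = p ∧
      -- there are distinct `α, β ∈ ⟨q⟩ ≤ F_r^×` with `α + β = 1`
      ∃ α β : ZMod r, α ≠ β ∧
        (∃ i : ℕ, ((Fintype.card F : ZMod r)) ^ i = α) ∧
        (∃ j : ℕ, ((Fintype.card F : ZMod r)) ^ j = β) ∧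
        α + β = 1 := by
  obtain ⟨hirr, hesq, hmin⟩ := hG
  have : NeZero p := ⟨hp.ne_zero⟩
  have hpM : Module.finrank F (Fin p → F) = p := Module.finrank_fin_fun F
  obtain ⟨T, hTG, hT⟩ := hirr.exists_commute_of_not_isAbsIrred hnabs
  obtain ⟨E, _, _, ρ, hρ, hX⟩ := Module.End.exists_field_of_commuting (by rwa [hpM])
    (natAct '' (G : Set (GL (Fin p) F)))
    (fun S hS => hirr.eq_bot_or_eq_top S fun g hg => hS _ ⟨g, hg, rfl⟩) T
    (by rintro _ ⟨g, hg, rfl⟩; exact hTG g hg) hT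
  obtain ⟨v₀, hv₀⟩ := exists_ne (0 : Fin p → F)
  have : Finite E := Finite.of_injective _ (hρ v₀ hv₀).1
  let φ : E ≃ₗ[F] (Fin p → F) :=
    .ofBijective ((LinearMap.applyₗ v₀).comp ρ.toLinearMap) (hρ v₀ hv₀)
  have hφ : ∀ a x, φ (a * x) = ρ a (φ x) := fun a x => LinearMap.congr_fun (map_mul ρ a x) v₀
  have hpE : Module.finrank F E = p := φ.finrank_eq.trans hpM
  have : IsSimpleOrder (Subalgebra F E) :=
    Subalgebra.isSimpleOrder_of_finrank_prime F E (by rwa [hpE])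
  have hρinj : Function.Injective ρ := ρ.toRingHom.injective
  choose f hf using fun g : G => hX (natAct g) ⟨g, g.2, rfl⟩
  replace hf : ∀ g : G, ρ (f g) = natAct (g : GL (Fin p) F) := hf
  let f' : G →* E :=
    { toFun := f
      map_one' := hρinj (by rw [hf, map_one]; exact natAct_one)
      map_mul' := fun g h => hρinj (by
        rw [hf, mul_comm, map_mul, hf, hf, ← natAct_mul]; rfl) }
  have hf'inj : Function.Injective f' := fun g h hgh => Subtype.ext (natAct_injective (by
    rw [← hf, ← hf]; exact congrArg ρ hgh))
  have hcyc : IsCyclic G := isCyclic_of_injective_ringHom f' hf'inj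
  have hgen : ∀ h : G, f' h ∉ (⊥ : Subalgebra F E) → orderOf h = Nat.card G := by
    intro h hh
    have hadj : Algebra.adjoin F {f' h} = ⊤ := (eq_bot_or_eq_top _).resolve_left fun hbot =>
      hh (hbot ▸ Algebra.self_mem_adjoin_singleton F (f' h))
    have hirr' : IsIrred (Subgroup.zpowers (h : GL (Fin p) F)) := by
      intro S hS
      have hstab : ∀ a ∈ Algebra.adjoin F {f' h}, ∀ v ∈ S, ρ a v ∈ S := by
        intro a ha
        induction ha using Algebra.adjoin_induction with
        | mem x hx =>
          obtain rfl := hx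
          intro v hv
          rw [show ρ (f' h) = _ from hf h]
          exact (hS _ (Subgroup.mem_zpowers _)).le (Submodule.mem_map_of_mem hv)
        | algebraMap c =>
          intro v hv
          rw [AlgHom.commutes, Module.algebraMap_end_apply]
          exact S.smul_mem c hv
        | add x y _ _ hx hy =>
          intro v hv
          rw [map_add]
          exact S.add_mem (hx v hv) (hy v hv)
        | mul x y _ _ hx hy =>
          intro v hv
          rw [map_mul]
          exact hx _ (hy v hv)
      refine or_iff_not_imp_left.2 fun hne => eq_top_iff.2 fun w _ => ?_
      obtain ⟨v, hv, hv0⟩ := S.exists_mem_ne_zero_of_ne_bot hne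
      obtain ⟨a, rfl⟩ := (hρ v hv0).2 w
      exact hstab a (hadj ▸ Algebra.mem_top) v hv
    have hle : Subgroup.zpowers (h : GL (Fin p) F) ≤ G := by simp
    have heq := hle.eq_of_not_lt fun hlt => hmin _ hlt hirr'
    rw [← Subgroup.orderOf_coe, ← Nat.card_zpowers, heq]
  obtain ⟨g, hg⟩ := hcyc.exists_generator
  have hgbot : f' g ∉ (⊥ : Subalgebra F E) := by
    intro hbot
    have hspan : F ∙ v₀ = ⊤ := by
      refine (hirr.eq_bot_or_eq_top (F ∙ v₀) fun h hh v hv => ?_).resolve_left (by simpa using hv₀)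
      obtain ⟨k, hk⟩ := mem_powers_iff_mem_zpowers.2 (hg ⟨h, hh⟩)
      have hh' : f' ⟨h, hh⟩ ∈ (⊥ : Subalgebra F E) := by
        rw [← hk]
        simpa using pow_mem hbot k
      obtain ⟨c, hc⟩ := Algebra.mem_bot.1 hh'
      have : natAct h = algebraMap F _ c := by
        rw [← ρ.commutes, hc]; exact (hf ⟨h, hh⟩).symm
      rw [Submodule.mem_comap, this, Module.algebraMap_end_apply]
      exact Submodule.smul_mem _ c hv
    have := finrank_span_singleton (K := F) hv₀
    rw [hspan, finrank_top, hpM] at this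
    exact hp.one_lt.ne' this
  have hpow : ∀ a b : ℕ, f' g ^ a = f' g ^ b ↔ a ≡ b [MOD Nat.card G] := by
    intro a b
    rw [← map_pow, ← map_pow, hf'inj.eq_iff, pow_eq_pow_iff_modEq, hgen g hgbot]
  obtain ⟨B, hB0, halt, hBG⟩ := hesq.exists_alternating
  obtain ⟨i, hi, j, hj, hij, hsum⟩ := exists_pow_mul_pow_eq_of_alternating
    ((B.compl₁₂ φ.toLinearMap φ.toLinearMap).compr₂ φ.symm.toLinearMap)
    (fun h0 => hB0 (LinearMap.ext₂ fun v w => by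
      simpa using LinearMap.congr_fun₂ h0 (φ.symm v) (φ.symm w)))
    (fun x => by simp [halt]) (f' g) (fun x y => by
      have hfg : ρ (f' g) = natAct (g : GL (Fin p) F) := hf g
      apply φ.injective
      simp [hφ, hfg, hBG g g.2])
  rw [hpE] at hi hj
  set q := Fintype.card F
  rw [← pow_add, ← pow_one (f' g), ← pow_mul, one_mul, hpow] at hsum
  have hfrob : ∀ x ∈ (⊥ : Subalgebra F E), x ^ q = x := by
    intro x hx
    obtain ⟨c, rfl⟩ := Algebra.mem_bot.1 hx
    rw [← map_pow, FiniteField.pow_card]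
  have hcard1 : Nat.card G ≠ 1 := by
    intro h1
    have : Subsingleton G := (Nat.card_eq_one_iff_unique.1 h1).1
    rw [Subsingleton.elim g 1, map_one] at hgbot
    exact hgbot (one_mem _)
  have hprime : (Nat.card G).Prime := by
    set r := (Nat.card G).minFac
    have hr : r.Prime := Nat.minFac_prime hcard1
    obtain ⟨m, hm⟩ : r ∣ Nat.card G := Nat.minFac_dvd _
    by_cases hm1 : m = 1
    · rw [hm, hm1, mul_one]; exact hr
    exfalso
    obtain ⟨s, hs, hsm⟩ := Nat.exists_prime_and_dvd hm1
    have hgr : f' (g ^ r) ∈ (⊥ : Subalgebra F E) := by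
      by_contra hcon
      have h1 := hgen _ hcon
      rw [orderOf_pow_of_dvd hr.ne_zero (hgen g hgbot ▸ Nat.minFac_dvd _), hgen g hgbot] at h1
      exact (Nat.div_lt_self Nat.card_pos hr.one_lt).ne h1
    have h2 := hfrob _ hgr
    rw [map_pow, ← pow_mul, hpow] at h2
    have h3 : q ≡ 1 [MOD m] := Nat.ModEq.mul_left_cancel' hr.ne_zero (by
      rw [← hm, mul_one]; exact h2)
    have h4 : q ≡ 1 [MOD s] := h3.of_dvd hsm
    have h5 : q ^ i + q ^ j ≡ 1 [MOD s] := hsum.of_dvd (hsm.trans (hm ▸ Dvd.intro_left r rfl))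
    have h6 : 1 ^ i + 1 ^ j ≡ 1 [MOD s] := ((h4.pow i).add (h4.pow j)).symm.trans h5
    simp only [one_pow] at h6
    have h7 := (Nat.modEq_iff_dvd' (by norm_num)).1 h6.symm
    exact hs.one_lt.ne' (Nat.dvd_one.1 h7)
  have hord : orderOf (q : ZMod (Nat.card G)) = p := by
    have := Fact.mk hp
    refine orderOf_eq_prime ?_ fun h1 => hgbot ?_
    · have : f' g ^ q ^ p = f' g ^ 1 := by
        have := Fintype.ofFinite E
        have hcardE : Fintype.card E = q ^ p :=
          Module.card_eq_pow_finrank.trans (congrArg (q ^ ·) hpE)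
        rw [pow_one, ← hcardE, FiniteField.pow_card]
      simpa using (ZMod.natCast_eq_natCast_iff _ _ _).2 ((hpow _ _).1 this)
    · have h2 : f' g ^ q = f' g ^ 1 :=
        (hpow _ _).2 ((ZMod.natCast_eq_natCast_iff _ _ _).1 (by simpa using h1))
      rw [pow_one] at h2
      exact FiniteField.mem_bot_of_pow_card_eq h2
  refine ⟨Nat.card G, hprime, hcyc, rfl, hord, _, _, fun h => hij ?_, ⟨i, rfl⟩, ⟨j, rfl⟩, ?_⟩
  · exact pow_injOn_Iio_orderOf (by simpa [hord] using hi) (by simpa [hord] using hj) h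
  · simpa using (ZMod.natCast_eq_natCast_iff _ _ _).2 hsum
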